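/- For every positive integer n, the number of pairs (a, j) with a a nonnegative integer and j an integer such that G_a + 2j² = n (so that each positive value 2j² is counted once for j and once for −j) is odd if and only if n is a generalized pentagonal number, i.e. n = G_m for some integer m ≥ 0. -/

import Mathlib

/-- The `n`-th triangular number `T n = n(n+1)/2`. -/
def T (n : ℕ) : ℕ := n * (n + 1) / 2

/-- The `n`-th generalized pentagonal number `G n = T n - T ⌊n/2⌋`. -/
def G (n : ℕ) : ℕ := T n - T (n / 2)

theorem T_succ (n : ℕ) : T (n + 1) = T n + (n + 1) := by
  unfold T
  rw [show (n + 1) * (n + 1 + 1) = n * (n + 1) + (n + 1) * 2 by ring,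
    Nat.add_mul_div_right _ _ two_pos]

theorem T_mono : Monotone T :=
  monotone_nat_of_le_succ fun n => by rw [T_succ]; exact Nat.le_add_right _ _

theorem G_strictMono : StrictMono G := by
  refine strictMono_nat_of_lt_succ fun n => ?_
  have hle : T (n / 2) ≤ T n := T_mono (Nat.div_le_self n 2)
  have hstep := T_succ n
  unfold G
  rcases Nat.even_or_odd' n with ⟨k, rfl | rfl⟩
  · rw [show (2 * k + 1) / 2 = 2 * k / 2 by lia]
    lia
  · have hhalf := T_succ ((2 * k + 1) / 2)
    rw [show (2 * k + 1 + 1) / 2 = (2 * k + 1) / 2 + 1 by lia]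
    lia

theorem finite_G_add_two_mul_sq (n : ℕ) :
    Finite {p : ℕ × ℤ // (G p.1 : ℤ) + 2 * p.2 ^ 2 = (n : ℤ)} := by
  refine Set.Finite.to_subtype
    (((Set.finite_Iic n).prod (Set.finite_Icc (-(n : ℤ)) n)).subset ?_)
  rintro ⟨a, j⟩ (h : (G a : ℤ) + 2 * j ^ 2 = n)
  have ha : a ≤ G a := G_strictMono.le_apply
  refine ⟨?_, ?_, ?_⟩
  · change a ≤ n
    have := sq_nonneg j
    lia
  · change -(n : ℤ) ≤ j
    nlinarith [sq_nonneg (j + 1)]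
  · change j ≤ (n : ℤ)
    nlinarith [sq_nonneg (j - 1)]

theorem stmt_10 (n : ℕ) (hn : 0 < n) :
    Odd (Nat.card {p : ℕ × ℤ // (G p.1 : ℤ) + 2 * p.2 ^ 2 = (n : ℤ)}) ↔ ∃ m, n = G m := by
  classical
  have := finite_G_add_two_mul_sq n
  have := Fintype.ofFinite {p : ℕ × ℤ // (G p.1 : ℤ) + 2 * p.2 ^ 2 = (n : ℤ)}
  let f : Function.End {p : ℕ × ℤ // (G p.1 : ℤ) + 2 * p.2 ^ 2 = (n : ℤ)} :=
    fun p => ⟨(p.1.1, -p.1.2), by simpa using p.2⟩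
  have hf : f ^ 2 ^ 1 = 1 := by
    funext p
    exact Subtype.ext (Prod.ext rfl (neg_neg p.1.2))
  have hfix (p) : p ∈ Function.fixedPoints f ↔ p.1.2 = 0 := by
    simp [f, Function.mem_fixedPoints, Function.IsFixedPt, Subtype.ext_iff, Prod.ext_iff,
      neg_eq_self]
  have hval (p) (hp : p ∈ Function.fixedPoints f) : G p.1.1 = n := by
    have := p.2
    rw [(hfix p).1 hp] at this
    simpa using this
  have hsub : Subsingleton (Function.fixedPoints f) := by
    refine ⟨fun ⟨p, hp⟩ ⟨q, hq⟩ => Subtype.ext (Subtype.ext (Prod.ext ?_ ?_))⟩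
    · exact G_strictMono.injective ((hval p hp).trans (hval q hq).symm)
    · exact ((hfix p).1 hp).trans ((hfix q).1 hq).symm
  have hcard := Equiv.Perm.card_fixedPoints_modEq (p := 2) hf
  rw [Nat.card_eq_fintype_card, Nat.odd_iff, hcard]
  have hle := Fintype.card_le_one_iff_subsingleton.2 hsub
  rw [Nat.mod_eq_of_lt (by lia)]
  constructor
  · intro h
    obtain ⟨p, hp⟩ := Fintype.card_pos_iff.1 (h ▸ one_pos)
    exact ⟨p.1.1, (hval p hp).symm⟩
  · rintro ⟨m, rfl⟩
    have : 0 < Fintype.card (Function.fixedPoints f) :=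
      Fintype.card_pos_iff.2 ⟨⟨⟨(m, 0), by simp⟩, (hfix _).2 rfl⟩⟩
    lia
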